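/- arXiv:math/0210290 — 5 statements merged into one kernel-verified Lean document; each statement's English description precedes it below -/
import Mathlib

section
/- There is a function N : ℝ → ℕ with the following property. Let L > 0, let K : ℝ → ℝ be a continuous L-periodic function, and set C = L · ∫₀^L max(K(t), 0) dt. If V is a finite-dimensional subspace of the real vector space of smooth L-periodic functions u : ℝ → ℝ such that ∫₀^L (u'(t)² − K(t)·u(t)²) dt < 0 for every nonzero u ∈ V, then dim V ≤ N(C). (Equivalently: the number of negative eigenvalues, counted with multiplicity, of the Schrödinger operator L u = u'' + K u on a circle of length L is bounded by N(C) whenever L·∫ max{K,0} ≤ C.) -/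
open MeasureTheory intervalIntegral

/-- One-dimensional Sobolev estimate: a `C¹` function vanishing at `s` satisfies
`u(t)² ≤ (t - s) ∫ₛᵗ u'²`. -/
theorem sq_le_mul_integral_deriv_sq {u : ℝ → ℝ} (hu : ContDiff ℝ 1 u) {s t : ℝ} (hst : s ≤ t)
    (hs : u s = 0) : u t ^ 2 ≤ (t - s) * ∫ x in s..t, deriv u x ^ 2 := by
  obtain rfl | hlt := hst.eq_or_lt
  · simp [hs]
  have hc : Continuous (deriv u) := hu.continuous_deriv le_rfl
  have hftc : ∫ x in s..t, deriv u x = u t := by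
    rw [integral_deriv_eq_sub (fun x _ => hu.differentiable one_ne_zero x)
      (hc.intervalIntegrable _ _), hs, sub_zero]
  have hpos : 0 < t - s := sub_pos.2 hlt
  set c := u t / (t - s)
  have hct : c * (t - s) = u t := div_mul_cancel₀ _ hpos.ne'
  have hnn : 0 ≤ ∫ x in s..t, (deriv u x - c) ^ 2 :=
    integral_nonneg hst fun x _ => sq_nonneg _
  have hexp : ∫ x in s..t, (deriv u x - c) ^ 2 =
      (∫ x in s..t, deriv u x ^ 2) - 2 * c * u t + (t - s) * c ^ 2 := by
    have h : ∀ x, (deriv u x - c) ^ 2 = deriv u x ^ 2 - 2 * c * deriv u x + c ^ 2 :=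
      fun x => by ring
    simp_rw [h]
    rw [integral_add (Continuous.intervalIntegrable (by fun_prop) _ _)
      (Continuous.intervalIntegrable (by fun_prop) _ _),
      integral_sub (Continuous.intervalIntegrable (by fun_prop) _ _)
      (Continuous.intervalIntegrable (by fun_prop) _ _),
      intervalIntegral.integral_const_mul, hftc, intervalIntegral.integral_const, smul_eq_mul]
  rw [hexp] at hnn
  have := mul_nonneg hpos.le hnn
  rw [← hct] at this ⊢
  nlinarith

/-- If `u` vanishes at the `n + 1` equally spaced nodes of `[0, L]` and `L ∫ K⁺ ≤ n`, then the
index form is nonnegative at `u`. -/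
theorem index_form_nonneg_of_eq_zero_on_nodes {L : ℝ} (hL : 0 < L) {K : ℝ → ℝ}
    (hK : Continuous K) {u : ℝ → ℝ} (hu : ContDiff ℝ 1 u) {n : ℕ} (hn : 0 < n)
    (hCn : L * ∫ t in (0:ℝ)..L, max (K t) 0 ≤ n)
    (hzero : ∀ k ≤ n, u (k * (L / n)) = 0) :
    0 ≤ ∫ t in (0:ℝ)..L, ((deriv u t) ^ 2 - K t * (u t) ^ 2) := by
  have hc : Continuous (deriv u) := hu.continuous_deriv le_rfl
  have huc : Continuous u := hu.continuous
  have hn' : (0 : ℝ) < n := Nat.cast_pos.2 hn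
  have hδ : 0 < L / n := div_pos hL hn'
  set D := ∫ x in (0:ℝ)..L, deriv u x ^ 2 with hD
  have hD0 : 0 ≤ D := integral_nonneg hL.le fun x _ => sq_nonneg _
  have hbound : ∀ t ∈ Set.Icc 0 L, u t ^ 2 ≤ L / n * D := by
    intro t ht
    set k := ⌊t / (L / n)⌋₊
    have hk1 : k * (L / n) ≤ t :=
      (le_div_iff₀ hδ).1 (Nat.floor_le (div_nonneg ht.1 hδ.le))
    have hk2 : t < (k + 1) * (L / n) := (div_lt_iff₀ hδ).1 (Nat.lt_floor_add_one _)
    have hkn : k ≤ n := by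
      have : (k : ℝ) * (L / n) ≤ n * (L / n) := by
        rw [mul_div_cancel₀ _ hn'.ne']
        exact hk1.trans ht.2
      exact_mod_cast le_of_mul_le_mul_right this hδ
    have hk0 : 0 ≤ (k : ℝ) * (L / n) := by positivity
    refine (sq_le_mul_integral_deriv_sq hu hk1 (hzero k hkn)).trans ?_
    refine mul_le_mul (by linarith) ?_ (integral_nonneg hk1 fun x _ => sq_nonneg _) hδ.le
    exact integral_mono_interval hk0 hk1 ht.2 (Filter.Eventually.of_forall fun x => sq_nonneg _)
      (Continuous.intervalIntegrable (by fun_prop) _ _)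
  have hmono : ∫ t in (0:ℝ)..L, (deriv u t ^ 2 - L / n * D * max (K t) 0) ≤
      ∫ t in (0:ℝ)..L, ((deriv u t) ^ 2 - K t * (u t) ^ 2) := by
    refine integral_mono_on hL.le (Continuous.intervalIntegrable (by fun_prop) _ _)
      (Continuous.intervalIntegrable (by fun_prop) _ _) fun t ht => ?_
    have h1 := mul_le_mul_of_nonneg_right (le_max_left (K t) 0) (sq_nonneg (u t))
    have h2 := mul_le_mul_of_nonneg_right (hbound t ht) (le_max_right (K t) 0)
    linarith
  refine le_trans ?_ hmono
  rw [integral_sub (Continuous.intervalIntegrable (by fun_prop) _ _)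
    (Continuous.intervalIntegrable (by fun_prop) _ _), intervalIntegral.integral_const_mul, ← hD,
    sub_nonneg]
  calc L / n * D * ∫ t in (0:ℝ)..L, max (K t) 0
      = (L * ∫ t in (0:ℝ)..L, max (K t) 0) / n * D := by ring
    _ ≤ 1 * D := mul_le_mul_of_nonneg_right ((div_le_one hn').2 hCn) hD0
    _ = D := one_mul D

/-- There is a function `N : ℝ → ℕ` such that for any period `L > 0` and any continuous
`L`-periodic potential `K`, any finite-dimensional subspace `V` of smooth `L`-periodic
functions on which the index form `u ↦ ∫₀^L (u'² - K u²)` is negative definite has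
dimension at most `N (L * ∫₀^L max (K t) 0)`. -/
theorem morse_index_bound_from_potential_integral :
    ∃ N : ℝ → ℕ,
      ∀ (L : ℝ), 0 < L →
      ∀ (K : ℝ → ℝ), Continuous K → Function.Periodic K L →
      ∀ (V : Submodule ℝ (ℝ → ℝ)),
        (∀ u ∈ V, ContDiff ℝ (⊤ : ℕ∞) u ∧ Function.Periodic u L) →
        (∀ u ∈ V, u ≠ 0 →
          (∫ t in (0:ℝ)..L, ((deriv u t) ^ 2 - K t * (u t) ^ 2)) < 0) →
        FiniteDimensional ℝ V →
        Module.finrank ℝ V ≤ N (L * ∫ t in (0:ℝ)..L, max (K t) 0) := by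
  refine ⟨fun C => ⌈C⌉₊ + 1 + 1, fun L hL K hK _ V hV hneg _ => ?_⟩
  set n := ⌈L * ∫ t in (0:ℝ)..L, max (K t) 0⌉₊ + 1
  let ev : V →ₗ[ℝ] (Fin (n + 1) → ℝ) :=
    (LinearMap.funLeft ℝ ℝ fun k : Fin (n + 1) => (k : ℝ) * (L / n)) ∘ₗ V.subtype
  have hinj : Function.Injective ev := by
    refine (injective_iff_map_eq_zero ev).2 fun u hu => ?_
    by_contra hne
    refine (hneg u u.2 fun h => hne (Subtype.ext h)).not_ge ?_
    refine index_form_nonneg_of_eq_zero_on_nodes hL hK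
      ((hV u u.2).1.of_le (by exact_mod_cast le_top)) (n := n) (Nat.succ_pos _) ?_ fun k hk => ?_
    · refine (Nat.le_ceil _).trans ?_
      exact_mod_cast Nat.le_succ _
    · exact congrFun hu ⟨k, Nat.lt_succ_of_le hk⟩
  simpa using LinearMap.finrank_le_finrank_of_injective hinj
end

section
/- There exist a sequence of periods Lₙ > 0 and smooth Lₙ-periodic functions Kₙ : ℝ → ℝ such that: (i) ∫₀^{Lₙ} Kₙ(t) dt ≤ 0 for every n; (ii) Lₙ · ∫₀^{Lₙ} max(Kₙ(t), 0) dt → ∞ as n → ∞; and (iii) for each n there is an n-dimensional subspace Vₙ of the space of smooth Lₙ-periodic functions u : ℝ → ℝ with ∫₀^{Lₙ} (u'(t)² − Kₙ(t)·u(t)²) dt < 0 for every nonzero u ∈ Vₙ. In particular, there is no uniform bound on the number of negative eigenvalues of the Schrödinger operators u ↦ u'' + Kₙ u on circles of length Lₙ, even though ∫ Kₙ ≤ 0. -/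
open MeasureTheory intervalIntegral Filter

/-- A smooth `1`-periodic function that vanishes near every integer. -/
noncomputable def cellBump (t : ℝ) : ℝ :=
  Real.smoothTransition (-Real.cos (2 * Real.pi * t))

theorem contDiff_cellBump : ContDiff ℝ (⊤ : ℕ∞) cellBump := by
  unfold cellBump
  have h := Real.smoothTransition.contDiff (n := (⊤ : ℕ∞))
  exact h.comp (by fun_prop)

theorem cellBump_periodic : Function.Periodic cellBump 1 := by
  intro t
  simp only [cellBump, mul_add, mul_one, Real.cos_add_two_pi]

theorem cellBump_eventuallyEq_zero (m : ℤ) : cellBump =ᶠ[nhds (m : ℝ)] 0 := by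
  have hc : Continuous fun t : ℝ => Real.cos (2 * Real.pi * t) := by fun_prop
  have h1 : Real.cos (2 * Real.pi * m) = 1 := by
    rw [mul_comm]
    exact Real.cos_int_mul_two_pi m
  have h0 : (0 : ℝ) < Real.cos (2 * Real.pi * m) := by rw [h1]; norm_num
  filter_upwards [hc.continuousAt.eventually (lt_mem_nhds h0)] with t ht
  exact Real.smoothTransition.zero_of_nonpos (by linarith)

theorem cellBump_zero : cellBump 0 = 0 := by
  simpa using (cellBump_eventuallyEq_zero 0).eq_of_nhds

theorem cellBump_half (k : ℤ) : cellBump (k + 1 / 2) = 1 := by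
  have h : Real.cos (2 * Real.pi * (k + 1 / 2)) = -1 := by
    rw [show 2 * Real.pi * ((k : ℝ) + 1 / 2) = k * (2 * Real.pi) + Real.pi by ring,
      Real.cos_int_mul_two_pi_add_pi]
  rw [cellBump, h, neg_neg, Real.smoothTransition.one]

/-- Multiplying a function vanishing near the integers by a function of the integer part amounts,
locally, to multiplying it by a constant. -/
theorem floor_mul_cellBump_eventuallyEq (c : ℤ → ℝ) (t : ℝ) :
    (fun s => c ⌊s⌋ * cellBump s) =ᶠ[nhds t] fun s => c ⌊t⌋ * cellBump s := by
  by_cases ht : (⌊t⌋ : ℝ) = t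
  · have h := cellBump_eventuallyEq_zero ⌊t⌋
    rw [ht] at h
    filter_upwards [h] with s hs
    simp [hs]
  · have h : Set.Ioo (⌊t⌋ : ℝ) (⌊t⌋ + 1) ∈ nhds t :=
      Ioo_mem_nhds (lt_of_le_of_ne (Int.floor_le t) ht) (Int.lt_floor_add_one t)
    filter_upwards [h] with s hs
    rw [Int.floor_eq_iff.2 ⟨hs.1.le, hs.2⟩]

theorem contDiff_floor_mul_cellBump (c : ℤ → ℝ) :
    ContDiff ℝ (⊤ : ℕ∞) fun t => c ⌊t⌋ * cellBump t :=
  contDiff_iff_contDiffAt.2 fun t =>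
    (contDiff_const.mul contDiff_cellBump).contDiffAt.congr_of_eventuallyEq
      (floor_mul_cellBump_eventuallyEq c t)

theorem deriv_floor_mul_cellBump (c : ℤ → ℝ) (t : ℝ) :
    deriv (fun t => c ⌊t⌋ * cellBump t) t = c ⌊t⌋ * deriv cellBump t := by
  rw [(floor_mul_cellBump_eventuallyEq c t).deriv_eq, deriv_const_mul_field]

theorem integral_floor_mul_of_periodic (c : ℤ → ℝ) {g : ℝ → ℝ} (hg : Continuous g)
    (hp : Function.Periodic g 1) (N : ℕ) :
    ∫ t in (0 : ℝ)..N, c ⌊t⌋ * g t =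
      (∑ k ∈ Finset.range N, c k) * ∫ t in (0 : ℝ)..1, g t := by
  have hcell (k : ℕ) : ∀ᵐ t ∂volume.restrict (Set.uIoc (k : ℝ) (k + 1 : ℕ)),
      c k * g t = c ⌊t⌋ * g t := by
    rw [Set.uIoc_of_le (by push_cast; linarith), ← Measure.restrict_congr_set Ico_ae_eq_Ioc]
    filter_upwards [ae_restrict_mem measurableSet_Ico] with t ht
    have : ⌊t⌋ = (k : ℤ) := Int.floor_eq_iff.2 ⟨by simpa using ht.1, by simpa using ht.2⟩
    rw [this]
  have hint (k : ℕ) : IntervalIntegrable (fun t => c ⌊t⌋ * g t) volume (k : ℝ) (k + 1 : ℕ) :=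
    ((continuous_const.mul hg).intervalIntegrable _ _ : IntervalIntegrable
      (fun t => c k * g t) volume _ _).congr_ae (hcell k)
  have hsum := sum_integral_adjacent_intervals (n := N) (a := fun k : ℕ => (k : ℝ))
    (fun k _ => hint k)
  rw [Nat.cast_zero] at hsum
  rw [← hsum, Finset.sum_mul]
  refine Finset.sum_congr rfl fun k _ => ?_
  rw [← integral_congr_ae_restrict (hcell k), intervalIntegral.integral_const_mul]
  have h := hp.intervalIntegral_add_eq (k : ℝ) 0
  rw [zero_add] at h
  rw [Nat.cast_add, Nat.cast_one, h]

theorem integral_of_periodic_one {g : ℝ → ℝ} (hg : Continuous g)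
    (hp : Function.Periodic g 1) (N : ℕ) :
    ∫ t in (0 : ℝ)..N, g t = N * ∫ t in (0 : ℝ)..1, g t := by
  simpa using integral_floor_mul_of_periodic (fun _ => 1) hg hp N

/-- A mean-zero smooth `1`-periodic potential whose index form is negative at `cellBump`. -/
theorem exists_potential_integral_neg :
    ∃ K : ℝ → ℝ, ContDiff ℝ (⊤ : ℕ∞) K ∧ Function.Periodic K 1 ∧
      ∫ t in (0 : ℝ)..1, K t = 0 ∧
      ∫ t in (0 : ℝ)..1, ((deriv cellBump t) ^ 2 - K t * (cellBump t) ^ 2) < 0 := by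
  have hφ : Continuous cellBump := contDiff_cellBump.continuous
  have hφ' : Continuous (deriv cellBump) := contDiff_cellBump.continuous_deriv (by simp)
  set m : ℝ := ∫ t in (0 : ℝ)..1, cellBump t ^ 2 with hm
  have hm0 : 0 < m :=
    integral_pos zero_lt_one (by fun_prop) (fun t _ => sq_nonneg _)
      ⟨1 / 2, by norm_num, by
        rw [show cellBump (1 / 2) = 1 by simpa using cellBump_half 0]
        norm_num⟩
  set v : ℝ := ∫ t in (0 : ℝ)..1, (cellBump t ^ 2 - m) ^ 2 with hv
  have hv0 : 0 < v :=
    integral_pos zero_lt_one (by fun_prop) (fun t _ => sq_nonneg _)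
      ⟨0, by norm_num, by
        rw [cellBump_zero, zero_pow two_ne_zero, zero_sub, neg_sq]
        exact pow_pos hm0 2⟩
  set d : ℝ := ∫ t in (0 : ℝ)..1, deriv cellBump t ^ 2 with hd
  have hd0 : 0 ≤ d := integral_nonneg zero_le_one fun t _ => sq_nonneg _
  have hmean : ∫ t in (0 : ℝ)..1, (cellBump t ^ 2 - m) = 0 := by
    rw [integral_sub ((by fun_prop : Continuous _).intervalIntegrable _ _)
      ((by fun_prop : Continuous _).intervalIntegrable _ _)]
    simp [← hm]
  refine ⟨fun t => (d + 1) / v * (cellBump t ^ 2 - m), ?_, ?_, ?_, ?_⟩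
  · exact contDiff_const.mul ((contDiff_cellBump.pow 2).sub contDiff_const)
  · intro t
    simp only [cellBump_periodic t]
  · rw [intervalIntegral.integral_const_mul, hmean, mul_zero]
  · have hsplit : ∀ t, deriv cellBump t ^ 2 -
        (d + 1) / v * (cellBump t ^ 2 - m) * cellBump t ^ 2 =
        deriv cellBump t ^ 2 - ((d + 1) / v * (cellBump t ^ 2 - m) ^ 2 +
          (d + 1) / v * m * (cellBump t ^ 2 - m)) := fun t => by ring
    simp only [hsplit]
    rw [integral_sub ((by fun_prop : Continuous _).intervalIntegrable _ _)
        ((by fun_prop : Continuous _).intervalIntegrable _ _),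
      integral_add ((by fun_prop : Continuous _).intervalIntegrable _ _)
        ((by fun_prop : Continuous _).intervalIntegrable _ _),
      intervalIntegral.integral_const_mul, intervalIntegral.integral_const_mul, hmean, ← hv, ← hd, div_mul_cancel₀ _ hv0.ne']
    linarith

/-- The extension of `a : Fin n → ℝ` by zero to `{0, …, n}`, and then `n + 1`-periodically. -/
def cellCoeff {n : ℕ} (a : Fin n → ℝ) (z : ℤ) : ℝ :=
  if h : (z % (n + 1 : ℤ)).toNat < n then a ⟨_, h⟩ else 0

theorem cellCoeff_natCast {n : ℕ} (a : Fin n → ℝ) (k : Fin n) :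
    cellCoeff a ((k : ℕ) : ℤ) = a k := by
  have h : (((k : ℕ) : ℤ) % (n + 1 : ℤ)).toNat = k := by
    rw [Int.emod_eq_of_lt (by omega) (by omega), Int.toNat_natCast]
  simp [cellCoeff, h]

theorem cellCoeff_add_period {n : ℕ} (a : Fin n → ℝ) (z : ℤ) :
    cellCoeff a (z + (n + 1 : ℤ)) = cellCoeff a z := by
  simp only [cellCoeff, Int.add_emod_right]

/-- The linear combinations of the `n` copies of `cellBump` in the first `n` of `n + 1` cells. -/
noncomputable def cellCombination (n : ℕ) : (Fin n → ℝ) →ₗ[ℝ] (ℝ → ℝ) where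
  toFun a t := cellCoeff a ⌊t⌋ * cellBump t
  map_add' a b := by
    ext t
    simp only [cellCoeff, Pi.add_apply]
    split_ifs <;> ring
  map_smul' r a := by
    ext t
    simp only [cellCoeff, Pi.smul_apply, smul_eq_mul, RingHom.id_apply]
    split_ifs <;> ring

theorem cellCombination_injective (n : ℕ) : Function.Injective (cellCombination n) := by
  intro a b hab
  ext k
  have h := congrFun hab (((k : ℕ) : ℤ) + 1 / 2)
  have hfl : ⌊(((k : ℕ) : ℤ) : ℝ) + 1 / 2⌋ = ((k : ℕ) : ℤ) :=
    Int.floor_eq_iff.2 ⟨by linarith, by linarith⟩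
  simpa only [cellCombination, LinearMap.coe_mk, AddHom.coe_mk, hfl, cellCoeff_natCast,
    cellBump_half, mul_one] using h

theorem cellCombination_periodic {n : ℕ} (a : Fin n → ℝ) :
    Function.Periodic (cellCombination n a) (n + 1 : ℕ) := by
  intro t
  have h := cellBump_periodic.nat_mul (n + 1) t
  rw [mul_one] at h
  simp only [cellCombination, LinearMap.coe_mk, AddHom.coe_mk, h, Int.floor_add_natCast]
  push_cast
  rw [cellCoeff_add_period]

theorem integral_cellCombination {K : ℝ → ℝ} (hK : Continuous K) (hp : Function.Periodic K 1)
    {n : ℕ} (a : Fin n → ℝ) :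
    ∫ t in (0 : ℝ)..(n + 1 : ℕ),
        ((deriv (cellCombination n a) t) ^ 2 - K t * (cellCombination n a t) ^ 2) =
      (∑ k ∈ Finset.range (n + 1), cellCoeff a k ^ 2) *
        ∫ t in (0 : ℝ)..1, ((deriv cellBump t) ^ 2 - K t * (cellBump t) ^ 2) := by
  have hφ : Continuous cellBump := contDiff_cellBump.continuous
  have hφ' : Continuous (deriv cellBump) := contDiff_cellBump.continuous_deriv (by simp)
  have hper : Function.Periodic (deriv cellBump) 1 := fun t => by
    rw [← deriv_comp_add_const, funext cellBump_periodic]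
  rw [← integral_floor_mul_of_periodic (fun z => cellCoeff a z ^ 2) (by fun_prop)
    (fun t => by simp only [hp t, cellBump_periodic t, hper t])]
  congr 1
  ext t
  have h := deriv_floor_mul_cellBump (cellCoeff a) t
  simp only [cellCombination, LinearMap.coe_mk, AddHom.coe_mk, h]
  ring

/-- There are periods `Lₙ > 0` and smooth `Lₙ`-periodic potentials `Kₙ` with `∫ Kₙ ≤ 0`,
`Lₙ · ∫ max (Kₙ) 0 → ∞`, and for each `n` an `n`-dimensional subspace of smooth
`Lₙ`-periodic functions on which the index form is negative definite; in particular there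
is no uniform bound on the number of negative eigenvalues. -/
theorem no_index_bound_from_integral_bounds :
    ∃ (L : ℕ → ℝ) (K : ℕ → ℝ → ℝ),
      (∀ n, 0 < L n) ∧
      (∀ n, ContDiff ℝ (⊤ : ℕ∞) (K n)) ∧
      (∀ n, Function.Periodic (K n) (L n)) ∧
      (∀ n, (∫ t in (0:ℝ)..(L n), K n t) ≤ 0) ∧
      Tendsto (fun n => L n * ∫ t in (0:ℝ)..(L n), max (K n t) 0) atTop atTop ∧
      (∀ n, ∃ V : Submodule ℝ (ℝ → ℝ),
        (∀ u ∈ V, ContDiff ℝ (⊤ : ℕ∞) u ∧ Function.Periodic u (L n)) ∧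
        (∀ u ∈ V, u ≠ 0 →
          (∫ t in (0:ℝ)..(L n), ((deriv u t) ^ 2 - K n t * (u t) ^ 2)) < 0) ∧
        FiniteDimensional ℝ V ∧
        Module.finrank ℝ V = n) := by
  obtain ⟨K, hK, hp, hmean, hneg⟩ := exists_potential_integral_neg
  have hφ : Continuous cellBump := contDiff_cellBump.continuous
  have hKc : Continuous K := hK.continuous
  have hpos : 0 < ∫ t in (0 : ℝ)..1, max (K t) 0 := by
    have hex : ∃ t ∈ Set.Icc (0 : ℝ) 1, 0 < K t := by
      by_contra! h
      refine hneg.not_ge (integral_nonneg zero_le_one fun t ht => ?_)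
      nlinarith [h t ht, sq_nonneg (deriv cellBump t), sq_nonneg (cellBump t)]
    obtain ⟨t, ht, hKt⟩ := hex
    exact integral_pos zero_lt_one (by fun_prop) (fun t _ => le_max_right _ _)
      ⟨t, ht, lt_max_of_lt_left hKt⟩
  refine ⟨fun n => (n + 1 : ℕ), fun _ => K, fun n => by positivity, fun _ => hK, fun n => ?_,
    fun n => ?_, ?_, fun n => ⟨LinearMap.range (cellCombination n), ?_, ?_, inferInstance, ?_⟩⟩
  · simpa using hp.nat_mul (n + 1)
  · rw [integral_of_periodic_one hKc hp, hmean, mul_zero]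
  · have heq (n : ℕ) : ∫ t in (0 : ℝ)..(n + 1 : ℕ), max (K t) 0 =
        (n + 1 : ℕ) * ∫ t in (0 : ℝ)..1, max (K t) 0 :=
      integral_of_periodic_one (by fun_prop) (fun t => by simp only [hp t]) _
    simp only [heq]
    have hN : Tendsto (fun n : ℕ => ((n + 1 : ℕ) : ℝ)) atTop atTop :=
      tendsto_natCast_atTop_atTop.comp (tendsto_add_atTop_nat 1)
    exact hN.atTop_mul_atTop₀ (hN.atTop_mul_const hpos)
  · rintro _ ⟨a, rfl⟩
    exact ⟨contDiff_floor_mul_cellBump (cellCoeff a), cellCombination_periodic a⟩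
  · rintro _ ⟨a, rfl⟩ hu
    rw [integral_cellCombination hKc hp]
    have ha : a ≠ 0 := fun h => hu (by rw [h, map_zero])
    obtain ⟨k, hk⟩ := Function.ne_iff.1 ha
    refine mul_neg_of_pos_of_neg (Finset.sum_pos' (fun _ _ => sq_nonneg _)
      ⟨k, Finset.mem_range.2 (by omega), ?_⟩) hneg
    rw [cellCoeff_natCast]
    exact sq_pos_of_ne_zero hk
  · rw [LinearMap.finrank_range_of_inj (cellCombination_injective n), Module.finrank_fin_fun]
end

section
/- For every n ∈ ℕ there exists a smooth ℤ²-periodic function V : ℝ² → ℝ (i.e. V(x + v) = V(x) for all v ∈ ℤ²) with ∫_{[0,1]²} V(x) dx ≤ 0, together with an n-dimensional subspace W of the space of smooth ℤ²-periodic functions u : ℝ² → ℝ such that ∫_{[0,1]²} (‖∇u(x)‖² − V(x)·u(x)²) dx < 0 for every nonzero u ∈ W. -/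
open MeasureTheory

/-- A continuous nonnegative function that is positive at an interior point of a compact set
has positive integral over that set. -/
theorem setIntegral_pos_of_mem_interior {K : Set (ℝ × ℝ)} (hK : IsCompact K)
    {g : ℝ × ℝ → ℝ} (hg : Continuous g) (h0 : ∀ x, 0 ≤ g x) {x : ℝ × ℝ}
    (hx : x ∈ interior K) (hgx : g x ≠ 0) : 0 < ∫ y in K, g y := by
  rw [setIntegral_pos_iff_support_of_nonneg_ae (Filter.Eventually.of_forall h0)
    (hg.continuousOn.integrableOn_compact hK)]
  have hopen : IsOpen (Function.support g ∩ interior K) :=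
    hg.isOpen_support.inter isOpen_interior
  exact (hopen.measure_pos volume ⟨x, hgx, hx⟩).trans_le
    (measure_mono (Set.inter_subset_inter_right _ interior_subset))

/-- On the span of finitely many smooth functions, linearly independent in `L²(K)`, the Dirichlet
energy over `K` is strictly dominated by a multiple of the squared `L²(K)` norm. -/
theorem exists_dirichlet_lt_mul_sq {n : ℕ} {K : Set (ℝ × ℝ)} (hK : IsCompact K)
    (e : Fin n → ℝ × ℝ → ℝ) (he : ∀ i, ContDiff ℝ (⊤ : ℕ∞) (e i))
    (hpos : ∀ a : Fin n → ℝ, a ≠ 0 → 0 < ∫ x in K, (∑ i, a i * e i x) ^ 2) :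
    ∃ A : ℝ, ∀ a : Fin n → ℝ, a ≠ 0 →
      (∫ x in K, ((fderiv ℝ (fun y => ∑ i, a i * e i y) x (1, 0)) ^ 2 +
        (fderiv ℝ (fun y => ∑ i, a i * e i y) x (0, 1)) ^ 2)) <
      A * ∫ x in K, (∑ i, a i * e i x) ^ 2 := by
  have hfd : ∀ (a : Fin n → ℝ) (x v : ℝ × ℝ),
      fderiv ℝ (fun y => ∑ i, a i * e i y) x v = ∑ i, a i * fderiv ℝ (e i) x v := by
    intro a x v
    have hd : ∀ i, DifferentiableAt ℝ (e i) x := fun i =>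
      ((he i).differentiable (by simp)).differentiableAt
    rw [fderiv_fun_sum fun i _ => (hd i).const_mul (a i)]
    simp [fderiv_const_mul (hd _)]
  simp only [hfd]
  have hcd : ∀ i v, Continuous fun x => fderiv ℝ (e i) x v := fun i v =>
    ((he i).continuous_fderiv (by simp)).clm_apply continuous_const
  have hce : ∀ i, Continuous (e i) := fun i => (he i).continuous
  set N : (Fin n → ℝ) → ℝ := fun a => ∫ x in K, (∑ i, a i * e i x) ^ 2 with hN
  set D : (Fin n → ℝ) → ℝ := fun a => ∫ x in K, ((∑ i, a i * fderiv ℝ (e i) x (1, 0)) ^ 2 +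
    (∑ i, a i * fderiv ℝ (e i) x (0, 1)) ^ 2) with hD
  have hNc : Continuous N := by
    refine continuous_parametric_integral_of_continuous ?_ hK
    unfold Function.uncurry
    fun_prop
  have hDc : Continuous D := by
    refine continuous_parametric_integral_of_continuous ?_ hK
    unfold Function.uncurry
    have h1 := fun i => (hcd i (1, 0)).comp (continuous_snd (X := Fin n → ℝ))
    have h2 := fun i => (hcd i (0, 1)).comp (continuous_snd (X := Fin n → ℝ))
    simp only [Function.comp_def] at h1 h2
    fun_prop
  have hNs : ∀ (c : ℝ) a, N (c • a) = c ^ 2 * N a := by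
    intro c a
    simp only [hN, ← integral_const_mul, Pi.smul_apply, smul_eq_mul, mul_assoc,
      ← Finset.mul_sum, mul_pow]
  have hDs : ∀ (c : ℝ) a, D (c • a) = c ^ 2 * D a := by
    intro c a
    simp only [hD, ← integral_const_mul, Pi.smul_apply, smul_eq_mul, mul_assoc,
      ← Finset.mul_sum, mul_pow, mul_add]
  obtain ⟨C, hC⟩ := (isCompact_sphere (0 : Fin n → ℝ) 1).exists_bound_of_continuousOn
    (f := fun a => D a / N a) (hDc.continuousOn.div hNc.continuousOn fun a ha =>
      (hpos a (ne_zero_of_mem_unit_sphere ⟨a, ha⟩)).ne')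
  refine ⟨|C| + 1, fun a ha => ?_⟩
  change D a < _ * N a
  have hna : ‖a‖ ≠ 0 := norm_ne_zero_iff.2 ha
  have hmem : ‖a‖⁻¹ • a ∈ Metric.sphere (0 : Fin n → ℝ) 1 := by
    simp [norm_smul, hna]
  have hb := hC _ hmem
  rw [hNs, hDs, mul_div_mul_left _ _ (by positivity), Real.norm_eq_abs] at hb
  rw [← div_lt_iff₀ (hpos a ha)]
  linarith [le_abs_self (D a / N a), le_abs_self C]

/-- A smooth `1`-periodic function supported where `sin (2πt) ≥ 0`. -/
noncomputable def sinGlue (t : ℝ) : ℝ := expNegInvGlue (Real.sin (2 * Real.pi * t))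

theorem contDiff_sinGlue : ContDiff ℝ (⊤ : ℕ∞) sinGlue :=
  expNegInvGlue.contDiff.comp (Real.contDiff_sin.comp (contDiff_const.mul contDiff_id))

theorem sinGlue_add_int (t : ℝ) (k : ℤ) : sinGlue (t + k) = sinGlue t := by
  unfold sinGlue
  rw [show 2 * Real.pi * (t + k) = 2 * Real.pi * t + k * (2 * Real.pi) by ring,
    Real.sin_add_int_mul_two_pi]

theorem sinGlue_neg_add_int (t : ℝ) (k : ℤ) : sinGlue (-(t + k)) = sinGlue (-t) := by
  rw [← sinGlue_add_int (-t) (-k)]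
  push_cast
  ring_nf

theorem sinGlue_neg_mul_self (t : ℝ) : sinGlue (-t) * sinGlue t = 0 := by
  unfold sinGlue
  rw [mul_neg, Real.sin_neg]
  rcases le_total (Real.sin (2 * Real.pi * t)) 0 with h | h
  · rw [expNegInvGlue.zero_of_nonpos h, mul_zero]
  · rw [expNegInvGlue.zero_of_nonpos (neg_nonpos.2 h), zero_mul]

theorem sinGlue_quarter_pos : 0 < sinGlue (1 / 4) := by
  unfold sinGlue
  rw [show 2 * Real.pi * (1 / 4) = Real.pi / 2 by ring, Real.sin_pi_div_two]
  exact expNegInvGlue.pos_of_pos one_pos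

theorem sinGlue_three_quarters : sinGlue (3 / 4) = 0 := by
  have h := sinGlue_neg_mul_self (3 / 4)
  rw [← sinGlue_add_int (-(3 / 4)) 1] at h
  norm_num at h
  exact h.resolve_left (by simpa using sinGlue_quarter_pos.ne')

theorem sinGlue_neg_three_quarters_pos : 0 < sinGlue (-(3 / 4)) := by
  rw [← sinGlue_add_int (-(3 / 4)) 1]
  norm_num
  simpa using sinGlue_quarter_pos

/-- The positive powers of `sinGlue` are linearly independent on `[1/4, 3/4]`. -/
theorem exists_sum_mul_sinGlue_pow_ne_zero {n : ℕ} {a : Fin n → ℝ} (ha : a ≠ 0) :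
    ∃ t ∈ Set.Icc (1 / 4 : ℝ) (3 / 4), ∑ i, a i * sinGlue t ^ ((i : ℕ) + 1) ≠ 0 := by
  by_contra! h
  apply ha
  set p : Polynomial ℝ := ∑ i : Fin n, Polynomial.monomial ((i : ℕ) + 1) (a i) with hp
  have hp0 : p = 0 := by
    refine p.eq_zero_of_infinite_isRoot ((Set.Icc_infinite sinGlue_quarter_pos).mono ?_)
    intro y hy
    rw [← sinGlue_three_quarters] at hy
    obtain ⟨t, ht, rfl⟩ := intermediate_value_Icc' (by norm_num)
      contDiff_sinGlue.continuous.continuousOn hy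
    simpa [hp, Polynomial.IsRoot, Polynomial.eval_finsetSum] using h t ht
  funext i
  have := congrArg (fun q => q.coeff ((i : ℕ) + 1)) hp0
  simpa [hp, Polynomial.finsetSum_coeff, Polynomial.coeff_monomial, Fin.val_inj] using this

/-- For every `n` there is a smooth `ℤ²`-periodic potential `V` on `ℝ²` with
`∫_{[0,1]²} V ≤ 0` and an `n`-dimensional subspace `W` of smooth `ℤ²`-periodic functions
on which the index form `u ↦ ∫_{[0,1]²} (‖∇u‖² - V u²)` is negative definite. -/
theorem two_dim_no_index_bound (n : ℕ) :
    ∃ V : ℝ × ℝ → ℝ,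
      ContDiff ℝ (⊤ : ℕ∞) V ∧
      (∀ (x : ℝ × ℝ) (v : ℤ × ℤ), V (x + ((v.1 : ℝ), (v.2 : ℝ))) = V x) ∧
      (∫ x in Set.Icc ((0:ℝ), (0:ℝ)) (1, 1), V x) ≤ 0 ∧
      ∃ W : Submodule ℝ ((ℝ × ℝ) → ℝ),
        (∀ u ∈ W, ContDiff ℝ (⊤ : ℕ∞) u ∧
          ∀ (x : ℝ × ℝ) (v : ℤ × ℤ), u (x + ((v.1 : ℝ), (v.2 : ℝ))) = u x) ∧
        (∀ u ∈ W, u ≠ 0 →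
          (∫ x in Set.Icc ((0:ℝ), (0:ℝ)) (1, 1),
            ((fderiv ℝ u x (1, 0)) ^ 2 + (fderiv ℝ u x (0, 1)) ^ 2
              - V x * (u x) ^ 2)) < 0) ∧
        FiniteDimensional ℝ W ∧
        Module.finrank ℝ W = n := by
  set K : Set (ℝ × ℝ) := Set.Icc ((0:ℝ), (0:ℝ)) (1, 1) with hKdef
  have hK : IsCompact K := isCompact_Icc
  have hmem_int : ∀ t ∈ Set.Icc (1 / 4 : ℝ) (3 / 4), (t, (1 / 2 : ℝ)) ∈ interior K := by
    intro t ht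
    rw [hKdef, ← Set.Icc_prod_Icc, interior_prod_eq, interior_Icc]
    exact ⟨⟨by linarith [ht.1], by linarith [ht.2]⟩, by norm_num, by norm_num⟩
  let e : Fin n → ℝ × ℝ → ℝ := fun i x => sinGlue x.1 ^ ((i : ℕ) + 1)
  have he : ∀ i, ContDiff ℝ (⊤ : ℕ∞) (e i) := fun i =>
    (contDiff_sinGlue.comp contDiff_fst).pow _
  have hsum : ∀ a : Fin n → ℝ, ContDiff ℝ (⊤ : ℕ∞) fun x => ∑ i, a i * e i x := fun a =>
    ContDiff.sum fun i _ => contDiff_const.mul (he i)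
  have hpos : ∀ a : Fin n → ℝ, a ≠ 0 → 0 < ∫ x in K, (∑ i, a i * e i x) ^ 2 := by
    intro a ha
    obtain ⟨t, ht, hne⟩ := exists_sum_mul_sinGlue_pow_ne_zero ha
    exact setIntegral_pos_of_mem_interior hK ((hsum a).continuous.pow 2)
      (fun x => sq_nonneg _) (hmem_int t ht) (pow_ne_zero 2 hne)
  obtain ⟨A, hA⟩ := exists_dirichlet_lt_mul_sq hK e he hpos
  let ψ : ℝ × ℝ → ℝ := fun x => sinGlue (-x.1)
  have hψ : ContDiff ℝ (⊤ : ℕ∞) ψ := contDiff_sinGlue.comp contDiff_fst.neg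
  have hψpos : 0 < ∫ x in K, ψ x :=
    setIntegral_pos_of_mem_interior hK hψ.continuous (fun x => expNegInvGlue.nonneg _)
      (hmem_int (3 / 4) (by norm_num)) sinGlue_neg_three_quarters_pos.ne'
  let B : ℝ := (∫ _ in K, A) / ∫ x in K, ψ x
  let T : (Fin n → ℝ) →ₗ[ℝ] (ℝ × ℝ → ℝ) := Fintype.linearCombination ℝ e
  have hT : ∀ a, T a = fun x => ∑ i, a i * e i x := fun a => by
    funext x
    simp [T, Fintype.linearCombination_apply]
  have hTinj : Function.Injective T := by
    refine (injective_iff_map_eq_zero T).2 fun a ha => ?_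
    by_contra hne
    have h := hpos a hne
    rw [hT] at ha
    simp [fun x => congrFun ha x] at h
  refine ⟨fun x => A - B * ψ x, contDiff_const.sub (contDiff_const.mul hψ), ?_, ?_,
    LinearMap.range T, ?_, ?_, inferInstance, ?_⟩
  · intro x v
    simp only [ψ, Prod.fst_add, sinGlue_neg_add_int]
  · have hi : IntegrableOn (fun x => B * ψ x) K :=
      (continuous_const.mul hψ.continuous).continuousOn.integrableOn_compact hK
    beta_reduce
    rw [integral_sub (continuous_const.continuousOn.integrableOn_compact hK) hi,
      integral_const_mul, div_mul_cancel₀ _ hψpos.ne', sub_self]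
  · rintro _ ⟨a, rfl⟩
    rw [hT]
    refine ⟨hsum a, fun x v => ?_⟩
    simp only [e, Prod.fst_add, sinGlue_add_int]
  · rintro _ ⟨a, rfl⟩ hne
    have ha : a ≠ 0 := fun h => hne (by rw [h, map_zero])
    rw [hT]
    have hVu : ∀ x, (A - B * ψ x) * (∑ i, a i * e i x) ^ 2 = A * (∑ i, a i * e i x) ^ 2 := by
      intro x
      have hψu : ψ x * ∑ i, a i * e i x = 0 := by
        rw [Finset.mul_sum]
        refine Finset.sum_eq_zero fun i _ => ?_
        simp only [ψ, e]
        linear_combination a i * sinGlue x.1 ^ (i : ℕ) * sinGlue_neg_mul_self x.1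
      linear_combination (-B * ∑ i, a i * e i x) * hψu
    have hfc : ∀ v, Continuous fun x => fderiv ℝ (fun y => ∑ i, a i * e i y) x v := fun v =>
      ((hsum a).continuous_fderiv (by simp)).clm_apply continuous_const
    have hi₁ : IntegrableOn (fun x => (fderiv ℝ (fun y => ∑ i, a i * e i y) x (1, 0)) ^ 2 +
        (fderiv ℝ (fun y => ∑ i, a i * e i y) x (0, 1)) ^ 2) K :=
      (((hfc _).pow 2).add ((hfc _).pow 2)).continuousOn.integrableOn_compact hK
    have hi₂ : IntegrableOn (fun x => A * (∑ i, a i * e i x) ^ 2) K :=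
      (continuous_const.mul ((hsum a).continuous.pow 2)).continuousOn.integrableOn_compact hK
    simp only [hVu]
    rw [integral_sub hi₁ hi₂, integral_const_mul, sub_neg]
    exact hA a ha
  · rw [LinearMap.finrank_range_of_inj hTinj, Module.finrank_fin_fun]
end

section
/- Let f : ℝ × ℝ → ℝ be a smooth function with f(s, θ + 2π) = f(s, θ), f(s, θ) > 0 for |s| ≤ 1, f(0, θ) = 1 and ∂_s f(0, θ) = 0 for all θ, and define K(θ) = −∂_s² f(0, θ). Let φ : ℝ → ℝ be a smooth positive 2π-periodic function and λ > 0 a real number such that φ''(θ) + K(θ)φ(θ) + λ φ(θ) = 0 for all θ. Then there exists α₀ > 1 such that for every α ≥ α₀ there exists ε ∈ (0, 1) with the following property: for all s ∈ (0, ε) and all θ ∈ ℝ, the symmetric 2×2 real matrix with entries H₁₁ = α(α−1) s^{α−2} φ^{−α}, H₁₂ = H₂₁ = α φ' φ^{−α−1} s^{α−1} (s·∂_s f/f − α), and H₂₂ = α s^{α−1} f ∂_s f φ^{−α} − α s^α φ'' φ^{−α−1} + α(α+1) s^α (φ')² φ^{−α−2} + α s^α φ' φ^{−α−1} (∂_θ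 f)/f (all functions evaluated at (s,θ) or θ) is positive definite. -/
open Real

/-- The partial derivative of a smooth function in its first variable is smooth. -/
theorem ContDiff.deriv_partial_fst {g : ℝ × ℝ → ℝ} (hg : ContDiff ℝ (⊤ : ℕ∞) g) :
    ContDiff ℝ (⊤ : ℕ∞) (fun p : ℝ × ℝ => deriv (fun s => g (s, p.2)) p.1) := by
  have h : (fun p : ℝ × ℝ => deriv (fun s => g (s, p.2)) p.1)
      = fun p => fderiv ℝ g p (1, 0) := by
    funext p
    have hd := (hg.differentiable (by simp) (p.1, p.2)).hasFDerivAt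
    exact (hd.comp_hasDerivAt p.1 ((hasDerivAt_id p.1).prodMk (hasDerivAt_const p.1 p.2))).deriv
  rw [h]
  exact (hg.fderiv_right (m := (⊤ : ℕ∞)) (by simp)).clm_apply contDiff_const

/-- The partial derivative of a smooth function in its second variable is smooth. -/
theorem ContDiff.deriv_partial_snd {g : ℝ × ℝ → ℝ} (hg : ContDiff ℝ (⊤ : ℕ∞) g) :
    ContDiff ℝ (⊤ : ℕ∞) (fun p : ℝ × ℝ => deriv (fun t => g (p.1, t)) p.2) :=
  (hg.comp (contDiff_snd.prodMk contDiff_fst)).deriv_partial_fst.comp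
    (contDiff_snd.prodMk contDiff_fst)

/-- The derivative of a periodic function is periodic. -/
theorem Function.Periodic.deriv_real {g : ℝ → ℝ} {c : ℝ} (hg : Function.Periodic g c) :
    Function.Periodic (deriv g) c := fun x => by
  rw [← deriv_comp_add_const, hg.funext]

/-- A symmetric real `2 × 2` matrix with positive leading principal minors is positive definite. -/
theorem Matrix.posDef_fin_two_of_minors_pos {a b d : ℝ} (ha : 0 < a) (hdet : 0 < a * d - b ^ 2) :
    Matrix.PosDef !![a, b; b, d] := by
  refine Matrix.PosDef.of_dotProduct_mulVec_pos ?_ fun x hx => ?_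
  · ext i j
    fin_cases i <;> fin_cases j <;> simp
  · have hx' : x 0 ≠ 0 ∨ x 1 ≠ 0 := by
      by_contra! h
      exact hx (by ext i; fin_cases i <;> simp [h.1, h.2])
    simp only [Matrix.mulVec, dotProduct, Fin.sum_univ_two, star_trivial, Matrix.of_apply,
      Matrix.cons_val', Matrix.cons_val_zero, Matrix.cons_val_one, Matrix.cons_val_fin_one]
    refine pos_of_mul_pos_right ?_ ha.le
    have hsq : a * (x 0 * (a * x 0 + b * x 1) + x 1 * (b * x 0 + d * x 1))
        = (a * x 0 + b * x 1) ^ 2 + (a * d - b ^ 2) * x 1 ^ 2 := by ring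
    rw [hsq]
    by_cases h1 : x 1 = 0
    · have h0 : x 0 ≠ 0 := hx'.resolve_right (not_not.2 h1)
      simp only [h1, mul_zero, add_zero, ne_eq, OfNat.ofNat_ne_zero, not_false_eq_true, zero_pow]
      positivity
    · positivity

/-- Pointwise criterion: after removing the common powers of `s` and `y`, positive definiteness
reduces to one scalar inequality. Here `y, y₁, y₂` stand for `φ, φ', φ''`, and
`w, ws, wt` for `f, ∂ₛf, ∂_θ f`. -/
theorem hessian_posDef_of_reduced_det_pos {α s y y₁ y₂ w ws wt k : ℝ} (hα : 1 < α) (hs : 0 < s)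
    (hy : 0 < y) (hws : ws = k * s)
    (hdet : 0 < (α - 1) * (w * k - y₂ / y + (α + 1) * (y₁ / y) ^ 2 + y₁ / y * (wt / w))
      - (y₁ / y) ^ 2 * (s * ws / w - α) ^ 2) :
    Matrix.PosDef
      !![α * (α - 1) * s ^ (α - 2) * y ^ (-α),
          α * y₁ * y ^ (-α - 1) * s ^ (α - 1) * (s * ws / w - α);
        α * y₁ * y ^ (-α - 1) * s ^ (α - 1) * (s * ws / w - α),
          α * s ^ (α - 1) * w * ws * y ^ (-α)
            - α * s ^ α * y₂ * y ^ (-α - 1)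
            + α * (α + 1) * s ^ α * y₁ ^ 2 * y ^ (-α - 2)
            + α * s ^ α * y₁ * y ^ (-α - 1) * wt / w] := by
  have hs1 : s ^ (α - 1) = s ^ (α - 2) * s := by
    rw [← rpow_add_one hs.ne']; ring_nf
  have hs2 : s ^ α = s ^ (α - 2) * s ^ 2 := by
    rw [← rpow_natCast s 2, ← rpow_add hs]; norm_num
  have hy1 : y ^ (-α - 1) = y ^ (-α) / y := rpow_sub_one hy.ne' _
  have hy2 : y ^ (-α - 2) = y ^ (-α) / y ^ 2 := by
    rw [rpow_sub hy]; norm_num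
  have hA : 0 < s ^ (α - 2) := rpow_pos_of_pos hs _
  have hC : 0 < y ^ (-α) := rpow_pos_of_pos hy _
  have hα1 : 0 < α - 1 := by linarith
  rw [hs1, hs2, hy1, hy2]
  generalize s ^ (α - 2) = A at hA
  generalize y ^ (-α) = C at hC
  refine Matrix.posDef_fin_two_of_minors_pos (by positivity) ?_
  have hα0 : 0 < α := by linarith
  have key := mul_pos (show 0 < (α * A * C * s) ^ 2 by positivity) hdet
  refine key.trans_eq ?_
  generalize s * ws / w - α = v
  subst hws
  ring

/-- Convexity of `F(s,θ) = s^α φ(θ)^{-α}` near a strictly stable closed geodesic: if `φ` is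
a positive eigenfunction of the Jacobi operator `φ'' + K φ` with eigenvalue `λ > 0`, then
for all sufficiently large `α > 1` there is `ε ∈ (0,1)` such that for `0 < s < ε` the
coordinate Hessian matrix of `F` is positive definite. -/
theorem hessian_posDef_near_strictly_stable_geodesic
    (f : ℝ × ℝ → ℝ) (hf : ContDiff ℝ (⊤ : ℕ∞) f)
    (hfper : ∀ s θ : ℝ, f (s, θ + 2 * π) = f (s, θ))
    (hfpos : ∀ s θ : ℝ, |s| ≤ 1 → 0 < f (s, θ))
    (hf0 : ∀ θ : ℝ, f (0, θ) = 1)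
    (hfs0 : ∀ θ : ℝ, deriv (fun s' => f (s', θ)) 0 = 0)
    (K : ℝ → ℝ)
    (hK : ∀ θ : ℝ, K θ = -deriv (fun s => deriv (fun s' => f (s', θ)) s) 0)
    (φ : ℝ → ℝ) (hφ : ContDiff ℝ (⊤ : ℕ∞) φ) (hφpos : ∀ θ, 0 < φ θ)
    (hφper : Function.Periodic φ (2 * π))
    (lam : ℝ) (hlam : 0 < lam)
    (heig : ∀ θ : ℝ, deriv (deriv φ) θ + K θ * φ θ + lam * φ θ = 0) :
    ∃ α₀ : ℝ, 1 < α₀ ∧ ∀ α : ℝ, α₀ ≤ α →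
      ∃ ε : ℝ, ε ∈ Set.Ioo (0:ℝ) 1 ∧ ∀ s : ℝ, s ∈ Set.Ioo (0:ℝ) ε → ∀ θ : ℝ,
        Matrix.PosDef
          !![α * (α - 1) * s ^ (α - 2) * (φ θ) ^ (-α),
              α * deriv φ θ * (φ θ) ^ (-α - 1) * s ^ (α - 1)
                * (s * deriv (fun s' => f (s', θ)) s / f (s, θ) - α);
            α * deriv φ θ * (φ θ) ^ (-α - 1) * s ^ (α - 1)
                * (s * deriv (fun s' => f (s', θ)) s / f (s, θ) - α),
              α * s ^ (α - 1) * f (s, θ) * deriv (fun s' => f (s', θ)) s * (φ θ) ^ (-α)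
                - α * s ^ α * deriv (deriv φ) θ * (φ θ) ^ (-α - 1)
                + α * (α + 1) * s ^ α * (deriv φ θ) ^ 2 * (φ θ) ^ (-α - 2)
                + α * s ^ α * deriv φ θ * (φ θ) ^ (-α - 1)
                  * (deriv (fun θ' => f (s, θ')) θ) / f (s, θ)] := by
  set fs : ℝ × ℝ → ℝ := fun p => deriv (fun s' => f (s', p.2)) p.1 with hfs_def
  set ft : ℝ × ℝ → ℝ := fun p => deriv (fun θ' => f (p.1, θ')) p.2 with hft_def
  set fss : ℝ × ℝ → ℝ := fun p => deriv (fun s => fs (s, p.2)) p.1 with hfss_def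
  have hfs : ContDiff ℝ (⊤ : ℕ∞) fs := hf.deriv_partial_fst
  have hft : Continuous ft := hf.deriv_partial_snd.continuous
  have hfss : Continuous fss := hfs.deriv_partial_fst.continuous
  have hφ1 : ContDiff ℝ (⊤ : ℕ∞) (deriv φ) := hφ.iterate_deriv 1
  have hφ2 : Continuous (deriv (deriv φ)) := (hφ.iterate_deriv 2).continuous
  have hφ0 : ∀ θ, φ θ ≠ 0 := fun θ => (hφpos θ).ne'
  have hp : Continuous fun θ => (deriv φ θ / φ θ) ^ 2 :=
    (hφ1.continuous.div hφ.continuous hφ0).pow 2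
  obtain ⟨P, hP⟩ := (isCompact_Icc (a := (0 : ℝ)) (b := 2 * π)).exists_bound_of_continuousOn
    hp.continuousOn
  have hP' : ∀ θ ∈ Set.Icc 0 (2 * π), (deriv φ θ / φ θ) ^ 2 ≤ P := fun θ hθ =>
    (le_abs_self _).trans (hP θ hθ)
  have hP0 : 0 ≤ P := (sq_nonneg _).trans (hP' 0 ⟨le_rfl, by positivity⟩)
  refine ⟨2 + P / lam, by linarith [div_nonneg hP0 hlam.le], fun α hα => ?_⟩
  have hα1 : 1 < α := by linarith [div_nonneg hP0 hlam.le]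
  let G : ℝ × ℝ → ℝ → ℝ := fun z θ =>
    (α - 1) * (f (z.1, θ) * fss (z.2, θ) - deriv (deriv φ) θ / φ θ
      + (α + 1) * (deriv φ θ / φ θ) ^ 2 + deriv φ θ / φ θ * (ft (z.1, θ) / f (z.1, θ)))
      - (deriv φ θ / φ θ) ^ 2 * (z.1 * fs (z.1, θ) / f (z.1, θ) - α) ^ 2
  have hGpos : ∀ θ ∈ Set.Icc 0 (2 * π), 0 < G (0, 0) θ := by
    intro θ hθ
    have hft0 : ft (0, θ) = 0 := by simp [hft_def, hf0]
    have hfss0 : fss (0, θ) = -K θ := by rw [hK θ, neg_neg]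
    have hφ'' : deriv (deriv φ) θ / φ θ = -K θ - lam := by
      rw [div_eq_iff (hφ0 θ)]
      linear_combination heig θ
    have hαlam : lam + P ≤ (α - 1) * lam := by
      have := mul_le_mul_of_nonneg_right hα hlam.le
      rw [add_mul, div_mul_cancel₀ _ hlam.ne'] at this
      linarith
    have hval : G (0, 0) θ = (α - 1) * lam - (deriv φ θ / φ θ) ^ 2 := by
      simp only [G, hft0, hfss0, hφ'', hf0]
      ring
    rw [hval]
    linarith [hP' θ hθ]
  have hGcont : ∀ θ, ContinuousAt (fun z : (ℝ × ℝ) × ℝ => G z.1 z.2) ((0, 0), θ) := by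
    intro θ
    have hfc := hf.continuous
    have hfsc := hfs.continuous
    have hφc := hφ.continuous
    have hφ1c := hφ1.continuous
    have hne : f (0, θ) ≠ 0 := by simp [hf0]
    have := hφ0 θ
    simp only [G]
    fun_prop (disch := assumption)
  have hev : ∀ᶠ z : ℝ × ℝ in nhds (0, 0), ∀ θ ∈ Set.Icc 0 (2 * π), 0 < G z θ :=
    isCompact_Icc.eventually_forall_of_forall_eventually fun θ hθ =>
      (hGcont θ).eventually_const_lt (hGpos θ hθ)
  obtain ⟨δ, hδ, hball⟩ := Metric.eventually_nhds_iff.1 hev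
  refine ⟨min δ (1 / 2), ⟨by positivity, (min_le_right _ _).trans_lt (by norm_num)⟩,
    fun s hs θ => ?_⟩
  have hfsper : ∀ s θ, fs (s, θ + 2 * π) = fs (s, θ) := fun s θ => by
    simp only [hfs_def, hfper]
  have hftper : ∀ s θ, ft (s, θ + 2 * π) = ft (s, θ) := fun s =>
    Function.Periodic.deriv_real (g := fun θ => f (s, θ)) (hfper s)
  have hφ1per := hφper.deriv_real
  have hφ2per := hφ1per.deriv_real
  obtain ⟨θ₀, hθ₀, hdata⟩ := Function.Periodic.exists_mem_Ico₀
    (f := fun θ => (φ θ, deriv φ θ, deriv (deriv φ) θ, f (s, θ), fs (s, θ), ft (s, θ)))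
    (c := 2 * π) (fun θ => by
      simp only [hφper θ, hφ1per θ, hφ2per θ, hfper, hfsper, hftper]) (by positivity) θ
  simp only [Prod.mk.injEq] at hdata
  obtain ⟨e0, e1, e2, e3, e4, e5⟩ := hdata
  change Matrix.PosDef
    !![_, _ * (s * fs (s, θ) / _ - _);
      _ * (s * fs (s, θ) / _ - _),
      _ * fs (s, θ) * _ - _ + _ + _ * ft (s, θ) / _]
  rw [e0, e1, e2, e3, e4, e5]
  obtain ⟨ξ, hξ, hslope⟩ := exists_deriv_eq_slope (fun s => fs (s, θ₀)) hs.1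
    (by have := hfs.continuous; fun_prop)
    (by have := hfs.differentiable (by simp); fun_prop)
  have hfs00 : fs (0, θ₀) = 0 := hfs0 θ₀
  rw [hfs00, sub_zero, sub_zero, eq_div_iff hs.1.ne'] at hslope
  refine hessian_posDef_of_reduced_det_pos (k := fss (ξ, θ₀)) hα1 hs.1 (hφpos θ₀) hslope.symm ?_
  refine hball (y := (s, ξ)) ?_ θ₀ (Set.Ico_subset_Icc_self hθ₀)
  have hsδ : s < δ := hs.2.trans_le (min_le_left _ _)
  rw [Prod.dist_eq, max_lt_iff]
  simp only [Real.dist_eq, sub_zero, abs_of_pos hs.1, abs_of_pos hξ.1]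
  exact ⟨hsδ, hξ.2.trans hsδ⟩
end

section
/- Let f : ℝ → ℝ be a smooth function whose closed support is contained in the open interval (0, 1/2). Let P : ℕ → ℝ² be a sequence of points and ρ : ℕ → ℝ a sequence of positive radii with ρᵢ ≤ 1 for all i, such that the closed balls B̄(Pᵢ, ρᵢ/2) are pairwise disjoint. Then the function u : ℝ² → ℝ defined by u(x) = Σᵢ exp(−1/ρᵢ) · f(‖x − Pᵢ‖ / ρᵢ) (at each point at most one summand is nonzero, so the sum is well defined) is a smooth (C^∞) function on ℝ². -/
open Metric

/-- A function of the norm is smooth if its profile is smooth and vanishes near `0`. -/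
lemma contDiff_comp_norm_of_zero_notMem_tsupport {E : Type*} [NormedAddCommGroup E]
    [InnerProductSpace ℝ E] {n : WithTop ℕ∞} {f : ℝ → ℝ} (hf : ContDiff ℝ n f)
    (h0 : (0 : ℝ) ∉ tsupport f) : ContDiff ℝ n fun x : E => f ‖x‖ := by
  rw [contDiff_iff_contDiffAt]
  intro x
  rcases eq_or_ne x 0 with rfl | hx
  · have h : ∀ᶠ y : E in nhds 0, f ‖y‖ = 0 := by
      have hcont : Filter.Tendsto (fun y : E => ‖y‖) (nhds 0) (nhds 0) := by
        simpa using (continuous_norm (E := E)).tendsto 0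
      exact hcont.eventually (notMem_tsupport_iff_eventuallyEq.mp h0)
    exact (contDiffAt_const (c := (0 : ℝ))).congr_of_eventuallyEq h
  · exact hf.contDiffAt.comp x (contDiffAt_norm ℝ hx)

/-- The factor `exp (-1 / r)` beats every power of `1 / r`. -/
lemma exp_neg_one_div_mul_inv_pow_le (k d : ℕ) {r : ℝ} (hr : 0 < r) :
    Real.exp (-1 / r) * r⁻¹ ^ k ≤ (k + d).factorial * r ^ d := by
  have h := Real.pow_div_factorial_le_exp r⁻¹ (inv_nonneg.mpr hr.le) (k + d)
  rw [div_le_iff₀ (by positivity)] at h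
  have hexp : Real.exp (-1 / r) * Real.exp r⁻¹ = 1 := by
    rw [← Real.exp_add, Real.exp_eq_one_iff, neg_div, one_div, neg_add_cancel]
  have hpow : r⁻¹ ^ k = r⁻¹ ^ (k + d) * r ^ d := by
    rw [pow_add, mul_assoc, ← mul_pow, inv_mul_cancel₀ hr.ne', one_pow, mul_one]
  calc Real.exp (-1 / r) * r⁻¹ ^ k
      = Real.exp (-1 / r) * (r⁻¹ ^ (k + d) * r ^ d) := by rw [hpow]
    _ ≤ Real.exp (-1 / r) * ((Real.exp r⁻¹ * (k + d).factorial) * r ^ d) := by gcongr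
    _ = (Real.exp (-1 / r) * Real.exp r⁻¹) * ((k + d).factorial * r ^ d) := by ring
    _ = (k + d).factorial * r ^ d := by rw [hexp, one_mul]

/-- The `k`-th derivative of a function rescaled by `r` and translated is bounded by
`r⁻¹ ^ k` times a bound for the `k`-th derivative of the original function. -/
lemma norm_iteratedFDeriv_const_mul_comp_smul_sub_le {E : Type*} [NormedAddCommGroup E]
    [NormedSpace ℝ E] {g : E → ℝ} {k : ℕ} (hg : ContDiff ℝ k g) {C : ℝ}
    (hC : ∀ x, ‖iteratedFDeriv ℝ k g x‖ ≤ C) {a r : ℝ} (ha : 0 ≤ a) (hr : 0 < r) (p x : E) :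
    ‖iteratedFDeriv ℝ k (fun y => a * g (r⁻¹ • (y - p))) x‖ ≤ a * r⁻¹ ^ k * C := by
  have hscaled : ContDiff ℝ k fun y => g (r⁻¹ • y) := hg.comp (contDiff_id.const_smul r⁻¹)
  have htranslated : ContDiff ℝ k fun y => g (r⁻¹ • (y - p)) :=
    hscaled.comp (contDiff_id.sub contDiff_const)
  have h := iteratedFDeriv_const_smul_apply' (a := a) (htranslated.contDiffAt (x := x))
  simp only [smul_eq_mul] at h
  rw [h, iteratedFDeriv_comp_sub (f := fun y => g (r⁻¹ • y)), iteratedFDeriv_comp_const_smul _ hg,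
    norm_smul, norm_smul, norm_pow, Real.norm_of_nonneg ha,
    Real.norm_of_nonneg (inv_nonneg.mpr hr.le), mul_assoc]
  gcongr
  exact hC _

/-- In a finite-dimensional space, the volumes of disjoint balls contained in a bounded set
are summable. -/
lemma summable_indicator_pow_finrank_of_pairwise_disjoint_closedBall {ι E : Type*} [Countable ι]
    [NormedAddCommGroup E] [NormedSpace ℝ E] [FiniteDimensional ℝ E] {p : ι → E} {r : ι → ℝ}
    (hr : ∀ i, 0 ≤ r i)
    (hdisj : Pairwise fun i j => Disjoint (closedBall (p i) (r i)) (closedBall (p j) (r j)))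
    {s : Set ι} {x : E} {R : ℝ} (hs : ∀ i ∈ s, closedBall (p i) (r i) ⊆ closedBall x R) :
    Summable (s.indicator fun i => r i ^ Module.finrank ℝ E) := by
  borelize E
  let μ : MeasureTheory.Measure E := MeasureTheory.Measure.addHaar
  have hsum : Summable fun i : s => μ.real (closedBall (p i) (r i)) := by
    refine ENNReal.summable_toReal (ne_top_of_le_ne_top
      (isCompact_closedBall x R).measure_lt_top.ne (le_trans
        (MeasureTheory.tsum_meas_le_meas_iUnion_of_disjoint μ
          (fun i : s => measurableSet_closedBall) ?_)
        (MeasureTheory.measure_mono (Set.iUnion_subset fun i : s => hs i i.2))))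
    exact fun i j hij => hdisj (Subtype.coe_injective.ne hij)
  rw [← summable_subtype_iff_indicator]
  have hpos : μ.real (ball (0 : E) 1) ≠ 0 :=
    (MeasureTheory.measureReal_ne_zero_iff MeasureTheory.measure_ball_lt_top.ne).mpr
      (measure_ball_pos μ 0 one_pos).ne'
  refine (summable_mul_right_iff hpos).mp (hsum.congr fun i => ?_)
  exact MeasureTheory.Measure.addHaar_real_closedBall μ (p i) (hr i)

/-- Rescaled copies of a smooth function supported in the ball of radius `1 / 2`, placed in
disjoint balls of radii `ρ i / 2` and weighted by `exp (-1 / ρ i)`, have a smooth sum. -/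
lemma contDiff_tsum_exp_neg_one_div_mul {ι E : Type*} [Countable ι] [NormedAddCommGroup E]
    [NormedSpace ℝ E] [FiniteDimensional ℝ E] {g : E → ℝ} (hg : ContDiff ℝ (⊤ : ℕ∞) g)
    (hsupp : Function.support g ⊆ closedBall 0 (1 / 2)) {p : ι → E} {ρ : ι → ℝ}
    (hρpos : ∀ i, 0 < ρ i) (hρle : ∀ i, ρ i ≤ 1)
    (hdisj : Pairwise fun i j =>
      Disjoint (closedBall (p i) (ρ i / 2)) (closedBall (p j) (ρ j / 2))) :
    ContDiff ℝ (⊤ : ℕ∞) fun x => ∑' i, Real.exp (-1 / ρ i) * g ((ρ i)⁻¹ • (x - p i)) := by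
  have hcompact : HasCompactSupport g :=
    .of_support_subset_isCompact (isCompact_closedBall 0 _) hsupp
  have hbound (k : ℕ) : ∃ C, ∀ x, ‖iteratedFDeriv ℝ k g x‖ ≤ C :=
    (hcompact.iteratedFDeriv k).exists_bound_of_continuous
      (hg.continuous_iteratedFDeriv (mod_cast le_top))
  choose C hC using hbound
  have hC0 (k : ℕ) : 0 ≤ C k := (norm_nonneg _).trans (hC k 0)
  rw [contDiff_iff_contDiffAt]
  intro x₀
  let b : ι → E → ℝ := fun i x => Real.exp (-1 / ρ i) * g ((ρ i)⁻¹ • (x - p i))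
  let s : Set ι := {i | dist x₀ (p i) ≤ 2}
  let d := Module.finrank ℝ E
  have hs : ∀ i ∈ s, closedBall (p i) (ρ i / 2) ⊆ closedBall x₀ 3 := by
    intro i hi
    refine closedBall_subset_closedBall' ?_
    have h1 : dist x₀ (p i) ≤ 2 := hi
    rw [dist_comm]
    linarith [hρle i]
  have hsum := summable_indicator_pow_finrank_of_pairwise_disjoint_closedBall
    (fun i => (half_pos (hρpos i)).le) hdisj hs
  have hb (i : ι) : ContDiff ℝ (⊤ : ℕ∞) (b i) :=
    contDiff_const.mul (hg.comp ((contDiff_id.sub contDiff_const).const_smul _))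
  have hlocal : ContDiff ℝ (⊤ : ℕ∞) fun x => ∑' i, s.indicator b i x := by
    refine contDiff_tsum
      (v := fun k i => ((k + d).factorial * 2 ^ d * C k) * s.indicator (fun i => (ρ i / 2) ^ d) i)
      (fun i => ?_) (fun k _ => hsum.mul_left _) (fun k i x _ => ?_)
    · by_cases hi : i ∈ s
      · simpa [hi] using hb i
      · rw [Set.indicator_of_notMem hi]
        exact contDiff_const
    · by_cases hi : i ∈ s
      · rw [Set.indicator_of_mem hi, Set.indicator_of_mem hi]
        calc ‖iteratedFDeriv ℝ k (b i) x‖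
            ≤ Real.exp (-1 / ρ i) * (ρ i)⁻¹ ^ k * C k :=
              norm_iteratedFDeriv_const_mul_comp_smul_sub_le (hg.of_le (mod_cast le_top)) (hC k)
                (Real.exp_nonneg _) (hρpos i) _ _
          _ ≤ (k + d).factorial * ρ i ^ d * C k :=
              mul_le_mul_of_nonneg_right (exp_neg_one_div_mul_inv_pow_le k d (hρpos i)) (hC0 k)
          _ = ((k + d).factorial * 2 ^ d * C k) * (ρ i / 2) ^ d := by
              rw [div_pow]
              field_simp
      · simp [hi]
  refine hlocal.contDiffAt.congr_of_eventuallyEq ?_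
  filter_upwards [ball_mem_nhds x₀ one_pos] with x hx
  refine tsum_congr fun i => ?_
  by_cases hi : i ∈ s
  · simp [hi, b]
  · have hfar : 2 < dist x₀ (p i) := not_le.mp hi
    have hx1 : dist x x₀ < 1 := hx
    have hdist : 1 < dist x (p i) := by
      linarith [dist_triangle x₀ x (p i), dist_comm x x₀]
    have hzero : g ((ρ i)⁻¹ • (x - p i)) = 0 := by
      by_contra hne
      have hmem := hsupp hne
      rw [mem_closedBall_zero_iff, norm_smul, norm_inv, Real.norm_of_nonneg (hρpos i).le,
        ← dist_eq_norm, inv_mul_le_iff₀ (hρpos i)] at hmem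
      linarith [hρle i]
    simp [hi, hzero]

/-- Adding infinitely many disjoint bumps keeps the conformal factor smooth: if `f` is a
smooth bump profile with closed support in `(0, 1/2)`, the `P i` are bump centers and
`ρ i ∈ (0,1]` bump radii with the closed balls `B̄(P i, ρ i / 2)` pairwise disjoint, then
`x ↦ ∑ᵢ e^{-1/ρᵢ} f(‖x - Pᵢ‖ / ρᵢ)` is smooth on `ℝ²`. -/
theorem sum_of_bumps_smooth
    (f : ℝ → ℝ) (hf : ContDiff ℝ (⊤ : ℕ∞) f) (hsupp : tsupport f ⊆ Set.Ioo (0:ℝ) (1/2))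
    (P : ℕ → EuclideanSpace ℝ (Fin 2)) (ρ : ℕ → ℝ)
    (hρpos : ∀ i, 0 < ρ i) (hρle : ∀ i, ρ i ≤ 1)
    (hdisj : Pairwise fun i j =>
      Disjoint (closedBall (P i) (ρ i / 2)) (closedBall (P j) (ρ j / 2))) :
    ContDiff ℝ (⊤ : ℕ∞) (fun x : EuclideanSpace ℝ (Fin 2) =>
      ∑' i, Real.exp (-1 / ρ i) * f (‖x - P i‖ / ρ i)) := by
  have hg : ContDiff ℝ (⊤ : ℕ∞) fun x : EuclideanSpace ℝ (Fin 2) => f ‖x‖ :=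
    contDiff_comp_norm_of_zero_notMem_tsupport hf fun h => lt_irrefl _ (hsupp h).1
  have hsupport : Function.support (fun x : EuclideanSpace ℝ (Fin 2) => f ‖x‖) ⊆
      closedBall 0 (1 / 2) := fun x hx =>
    mem_closedBall_zero_iff.mpr (hsupp (subset_tsupport f hx)).2.le
  have h := contDiff_tsum_exp_neg_one_div_mul hg hsupport hρpos hρle hdisj
  convert h using 5 with x i
  rw [norm_smul, norm_inv, Real.norm_of_nonneg (hρpos i).le, inv_mul_eq_div]
end
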